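/- Let Σ be a set of N distinct complex numbers and 1 ≤ m ≤ N. Then: (i) Σ_{Ω ⊆ Σ, |Ω| = m} Q_Ω = 1 as an identity in ℂ[x₁,…,x_m]; (ii) for every Ω ⊆ Σ with |Ω| = m, Q_Ω² − Q_Ω lies in the ideal I; and (iii) for all Ω, Ω' ⊆ Σ with |Ω| = |Ω'| = m and Ω ≠ Ω', the product Q_Ω·Q_{Ω'} lies in the ideal I. In other words, the images of the Q_Ω in Sym/I form a complete set of pairwise orthogonal idempotents summing to 1. -/

import Mathlib

set_option synthInstance.maxHeartbeats 1000000
set_option maxHeartbeats 1000000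

open MvPolynomial

lemma Q_isSymmetric (m : ℕ) (c : ℂ) (T : Finset ℂ) :
    MvPolynomial.IsSymmetric (C c * ∏ i : Fin m, ∏ r ∈ T, (X i - C r) : MvPolynomial (Fin m) ℂ) := by
  intro e
  simp only [map_mul, map_prod, map_sub, rename_X, rename_C]
  congr 1
  exact Equiv.prod_comp e fun i => ∏ r ∈ T, ((X i : MvPolynomial (Fin m) ℂ) - C r)

/-- The symmetric polynomial
`Q_Ω := (∏ᵢ ∏_{r∈Σ∖Ω} (xᵢ − r)) / (∏_{s∈Ω} ∏_{r∈Σ∖Ω} (s − r))`, as an element of the algebra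
of symmetric polynomials in `m` variables. -/
noncomputable def QSym (m : ℕ) (S Ω : Finset ℂ) : symmetricSubalgebra (Fin m) ℂ :=
  ⟨C ((∏ s ∈ Ω, ∏ r ∈ S \ Ω, (s - r))⁻¹) * ∏ i : Fin m, ∏ r ∈ S \ Ω, (X i - C r),
   (mem_symmetricSubalgebra _).2 (Q_isSymmetric m _ _)⟩

/-- The `k`-th complete homogeneous symmetric polynomial in `m` variables, as an element of the
subalgebra of symmetric polynomials. -/
noncomputable def hSymElt (m k : ℕ) : symmetricSubalgebra (Fin m) ℂ :=
  ⟨hsymm (Fin m) ℂ k, (mem_symmetricSubalgebra _).2 (hsymm_isSymmetric (Fin m) ℂ k)⟩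

/-- `h_k(X−Σ)` as an element of the algebra of symmetric polynomials in `m` variables. -/
noncomputable def hXSElt (m : ℕ) (S : Multiset ℂ) (k : ℕ) : symmetricSubalgebra (Fin m) ℂ :=
  ∑ j ∈ Finset.range (k + 1), ((-1 : ℂ) ^ j * S.esymm j) • hSymElt m (k - j)

section GeneratingSeries

variable {A : Type*} [CommRing A]

lemma one_sub_C_mul_X_mul_mk_pow (a : A) :
    (1 - PowerSeries.C a * PowerSeries.X) * PowerSeries.mk (fun n => a ^ n) = 1 := by
  ext n
  rw [sub_mul, one_mul, mul_assoc, map_sub, PowerSeries.coeff_C_mul]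
  cases n with
  | zero => simp
  | succ n => simp [PowerSeries.coeff_succ_X_mul, PowerSeries.coeff_one, pow_succ']

lemma coeff_prod_one_sub_C_mul_X (s : Multiset A) (j : ℕ) :
    PowerSeries.coeff j (s.map fun a => 1 - PowerSeries.C a * PowerSeries.X).prod =
      (-1) ^ j * s.esymm j := by
  induction s using Multiset.induction_on generalizing j with
  | empty =>
    cases j <;> simp [Multiset.esymm, PowerSeries.coeff_one, Multiset.powersetCard_zero_right]
  | cons a s ih =>
    rw [Multiset.map_cons, Multiset.prod_cons, sub_mul, one_mul, mul_assoc, map_sub,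
      PowerSeries.coeff_C_mul, ih]
    cases j with
    | zero => simp [Multiset.esymm]
    | succ j =>
      rw [PowerSeries.coeff_succ_X_mul, ih]
      simp only [Multiset.esymm, Multiset.powersetCard_cons, Multiset.map_add, Multiset.sum_add,
        Multiset.map_map, Function.comp_def, Multiset.prod_cons, Multiset.sum_map_mul_left]
      ring

/-- For `#T ≤ n`, the coefficient of `zⁿ` in `∏ (1 - aᵢ z) / (1 - r z)` is
`r ^ (n - #T) ∏ (r - aᵢ)`. -/
lemma coeff_prod_one_sub_mul_mk_pow {ι : Type*} (T : Finset ι) (a : ι → A) (r : A) (d : ℕ) :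
    PowerSeries.coeff (T.card + d)
      ((∏ i ∈ T, (1 - PowerSeries.C (a i) * PowerSeries.X)) * PowerSeries.mk (fun n => r ^ n)) =
      r ^ d * ∏ i ∈ T, (r - a i) := by
  classical
  induction T using Finset.induction_on generalizing d with
  | empty => simp
  | insert i T hi ih =>
    rw [Finset.prod_insert hi, Finset.prod_insert hi, Finset.card_insert_of_notMem hi, mul_assoc,
      sub_mul, one_mul, mul_assoc, map_sub, PowerSeries.coeff_C_mul,
      show T.card + 1 + d = T.card + d + 1 by ring, PowerSeries.coeff_succ_X_mul, ih,
      add_assoc, ih]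
    ring

end GeneratingSeries

lemma mk_hsymm_eq_prod {σ R : Type*} [Fintype σ] [DecidableEq σ] [CommRing R] :
    PowerSeries.mk (fun n => hsymm σ R n) =
      ∏ i : σ, PowerSeries.mk (fun n => (X i : MvPolynomial σ R) ^ n) := by
  ext1 n
  rw [PowerSeries.coeff_prod, PowerSeries.coeff_mk, hsymm]
  refine Finset.sum_bij' (fun s _ => Multiset.toFinsupp s.1)
    (fun l hl => ⟨Finsupp.toMultiset l, ?_⟩) ?_ ?_ ?_ ?_ ?_
  · rw [Finset.mem_finsuppAntidiag] at hl
    rw [Finsupp.card_toMultiset, ← hl.1, Finsupp.sum_fintype _ _ (fun _ => rfl)]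
    rfl
  · intro s _
    rw [Finset.mem_finsuppAntidiag]
    refine ⟨?_, Finset.subset_univ _⟩
    exact (Multiset.sum_count_eq_card fun _ _ => Finset.mem_univ _).trans s.2
  · intros; exact Finset.mem_univ _
  · intro s _
    exact Subtype.ext (Multiset.toFinsupp_toMultiset s.1)
  · intro l _
    exact Finsupp.toMultiset_toFinsupp l
  · intro s _
    simp only [PowerSeries.coeff_mk, Multiset.toFinsupp_apply]
    rw [Finset.prod_multiset_map_count]
    refine Finset.prod_subset (Finset.subset_univ _) fun i _ hi => ?_
    rw [Multiset.count_eq_zero_of_notMem (by simpa using hi), pow_zero]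

lemma prod_one_sub_mul_mk_hsymm {σ R : Type*} [Fintype σ] [DecidableEq σ] [CommRing R] :
    (∏ i : σ, (1 - PowerSeries.C (X i : MvPolynomial σ R) * PowerSeries.X)) *
      PowerSeries.mk (fun n => hsymm σ R n) = 1 := by
  simp [mk_hsymm_eq_prod, ← Finset.prod_mul_distrib, one_sub_C_mul_X_mul_mk_pow]

/-- The generating series of `h_k(X - Σ)` is `∏_{s ∈ Σ} (1 - s z) · ∑ h_k zᵏ`. -/
lemma mk_hXSElt (m : ℕ) (S : Finset ℂ) :
    PowerSeries.mk (fun k => (hXSElt m S.val k : MvPolynomial (Fin m) ℂ)) =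
      (∏ s ∈ S, (1 - PowerSeries.C (C s) * PowerSeries.X)) *
        PowerSeries.mk (fun n => hsymm (Fin m) ℂ n) := by
  have hmap : (∏ s ∈ S, (1 - PowerSeries.C (C s : MvPolynomial (Fin m) ℂ) * PowerSeries.X)) =
      PowerSeries.map C (S.val.map fun s => 1 - PowerSeries.C s * PowerSeries.X).prod := by
    change _ = PowerSeries.map C (∏ s ∈ S, (1 - PowerSeries.C s * PowerSeries.X))
    simp [map_prod]
  ext1 k
  rw [hmap, PowerSeries.coeff_mul, PowerSeries.coeff_mk, Finset.Nat.sum_antidiagonal_eq_sum_range_succ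
    (fun i j => PowerSeries.coeff i (PowerSeries.map C _) * PowerSeries.coeff j _), hXSElt,
    AddSubmonoidClass.coe_finsetSum]
  refine Finset.sum_congr rfl fun j _ => ?_
  rw [PowerSeries.coeff_map, coeff_prod_one_sub_C_mul_X, PowerSeries.coeff_mk, ← smul_eq_C_mul]
  rfl

/-- The coefficient of `zⁿ` in `∏ (1 - xᵢ z) / (1 - r z)`, as a symmetric polynomial. -/
noncomputable def elemGeomCoeff (m : ℕ) (r : ℂ) (n : ℕ) : symmetricSubalgebra (Fin m) ℂ :=
  ⟨PowerSeries.coeff n ((∏ i : Fin m, (1 - PowerSeries.C (X i) * PowerSeries.X)) *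
      PowerSeries.mk (fun n => (C r : MvPolynomial (Fin m) ℂ) ^ n)), by
    rw [mem_symmetricSubalgebra]
    intro e
    have hcoe : ∀ F : PowerSeries (MvPolynomial (Fin m) ℂ), rename e (PowerSeries.coeff n F) =
        PowerSeries.coeff n (PowerSeries.map (rename e : _ →ₐ[ℂ] MvPolynomial (Fin m) ℂ).toRingHom F) :=
      fun F => by rw [PowerSeries.coeff_map]; rfl
    rw [hcoe, map_mul, map_prod]
    congr 2
    · rw [← Equiv.prod_comp e fun i => 1 - PowerSeries.C (X i : MvPolynomial (Fin m) ℂ) *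
        PowerSeries.X]
      simp
    · ext1 k
      simp⟩

/-- The symmetric polynomial `∏ (xᵢ - r)`. -/
noncomputable def prodXSub (m : ℕ) (r : ℂ) : symmetricSubalgebra (Fin m) ℂ :=
  ⟨∏ i : Fin m, (X i - C r), (mem_symmetricSubalgebra _).2 <| by
    simpa using Q_isSymmetric m 1 {r}⟩

lemma elemGeomCoeff_add (m : ℕ) (r : ℂ) (d : ℕ) :
    elemGeomCoeff m r (m + d) = ((-1) ^ m * r ^ d : ℂ) • prodXSub m r := by
  apply Subtype.ext
  have h := coeff_prod_one_sub_mul_mk_pow (Finset.univ : Finset (Fin m))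
    (fun i => (X i : MvPolynomial (Fin m) ℂ)) (C r) d
  rw [Finset.card_univ, Fintype.card_fin] at h
  have hneg : ∏ i : Fin m, (C r - X i : MvPolynomial (Fin m) ℂ) =
      (-1) ^ m * ∏ i : Fin m, (X i - C r) := by
    rw [← Fin.prod_const, ← Finset.prod_mul_distrib]
    simp
  refine h.trans ?_
  rw [hneg]
  change _ = ((-1) ^ m * r ^ d : ℂ) • ∏ i : Fin m, (X i - C r : MvPolynomial (Fin m) ℂ)
  rw [smul_eq_C_mul]
  simp only [map_mul, map_pow, map_neg, map_one]
  ring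

lemma sum_hXSElt_mul_elemGeomCoeff (m : ℕ) (S : Finset ℂ) {r : ℂ} (hr : r ∈ S) :
    ∑ k ∈ Finset.range (S.card + 1), hXSElt m S.val k * elemGeomCoeff m r (S.card - k) = 0 := by
  apply Subtype.ext
  rw [AddSubmonoidClass.coe_finsetSum]
  have hB := coeff_prod_one_sub_mul_mk_pow S (fun s => (C s : MvPolynomial (Fin m) ℂ)) (C r) 0
  have hzero : ∏ s ∈ S, (C r - C s : MvPolynomial (Fin m) ℂ) = 0 :=
    Finset.prod_eq_zero hr (sub_self _)
  rw [hzero, mul_zero, add_zero] at hB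
  have hser : PowerSeries.mk (fun k => (hXSElt m S.val k : MvPolynomial (Fin m) ℂ)) *
      ((∏ i : Fin m, (1 - PowerSeries.C (X i) * PowerSeries.X)) *
        PowerSeries.mk (fun n => (C r : MvPolynomial (Fin m) ℂ) ^ n)) =
      (∏ s ∈ S, (1 - PowerSeries.C (C s) * PowerSeries.X)) *
        PowerSeries.mk (fun n => (C r : MvPolynomial (Fin m) ℂ) ^ n) := by
    rw [mk_hXSElt]
    linear_combination (∏ s ∈ S, (1 - PowerSeries.C (C s) * PowerSeries.X)) *
        PowerSeries.mk (fun n => (C r : MvPolynomial (Fin m) ℂ) ^ n) *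
        prod_one_sub_mul_mk_hsymm (σ := Fin m) (R := ℂ)
  rw [← hser, PowerSeries.coeff_mul, Finset.Nat.sum_antidiagonal_eq_sum_range_succ
    (fun i j => PowerSeries.coeff i _ * PowerSeries.coeff j _)] at hB
  simp only [PowerSeries.coeff_mk] at hB
  exact hB

lemma hXSElt_zero (m : ℕ) (S : Multiset ℂ) : hXSElt m S 0 = 1 := by
  apply Subtype.ext
  simp [hXSElt, hSymElt, Multiset.esymm]

lemma prodXSub_mul_sum_mem (m : ℕ) (S : Finset ℂ) (hm : m ≤ S.card) {r : ℂ} (hr : r ∈ S) :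
    prodXSub m r * ∑ k ∈ Finset.range (S.card - m + 1), r ^ (S.card - m - k) • hXSElt m S.val k ∈
      Ideal.span ((fun k => hXSElt m S.val k) '' Set.Icc (S.card + 1 - m) S.card) := by
  set I := Ideal.span ((fun k => hXSElt m S.val k) '' Set.Icc (S.card + 1 - m) S.card)
  have hsum := sum_hXSElt_mul_elemGeomCoeff m S hr
  rw [← Finset.sum_range_add_sum_Ico _ (show S.card - m + 1 ≤ S.card + 1 by omega)] at hsum
  have hhigh : ∑ k ∈ Finset.Ico (S.card - m + 1) (S.card + 1),
      hXSElt m S.val k * elemGeomCoeff m r (S.card - k) ∈ I := by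
    refine I.sum_mem fun k hk => I.mul_mem_right _ (Ideal.subset_span ⟨k, ?_, rfl⟩)
    rw [Finset.mem_Ico] at hk
    exact ⟨by omega, by omega⟩
  have hlow := I.neg_mem hhigh
  rw [← eq_neg_of_add_eq_zero_left hsum] at hlow
  have hrw : prodXSub m r * ∑ k ∈ Finset.range (S.card - m + 1),
      r ^ (S.card - m - k) • hXSElt m S.val k =
      ((-1) ^ m : ℂ) • ∑ k ∈ Finset.range (S.card - m + 1),
        hXSElt m S.val k * elemGeomCoeff m r (S.card - k) := by
    rw [Finset.mul_sum, Finset.smul_sum]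
    refine Finset.sum_congr rfl fun k hk => ?_
    rw [Finset.mem_range] at hk
    rw [show S.card - k = m + (S.card - m - k) by omega, elemGeomCoeff_add, mul_smul_comm,
      mul_smul_comm, smul_smul, ← mul_assoc, ← mul_pow, mul_comm (prodXSub m r)]
    simp
  rw [hrw]
  exact Submodule.smul_of_tower_mem I _ hlow

/-- If `∑ rᵈ⁻ᵏ Hₖ` is killed by `U r` modulo `I` for `d + 1` distinct scalars `r` and `H₀ = 1`,
then `∏ U r` lies in `I`. -/
lemma prod_mem_of_mul_sum_mem {F R : Type*} [Field F] [CommRing R] [Algebra F R] (I : Ideal R)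
    (U : F → R) (H : ℕ → R) (hH : H 0 = 1) (d : ℕ) (T : Finset F) (hT : T.card = d + 1)
    (hU : ∀ r ∈ T, U r * ∑ k ∈ Finset.range (d + 1), r ^ (d - k) • H k ∈ I) :
    ∏ r ∈ T, U r ∈ I := by
  classical
  have hcoeff : ∀ j ≤ d, ∑ r ∈ T, (∏ s ∈ T.erase r, (r - s))⁻¹ * r ^ j =
      if d = j then 1 else 0 := by
    intro j hj
    have h := Lagrange.coeff_eq_sum (s := T) (v := id) (Set.injOn_id _)
      (P := (Polynomial.X : Polynomial F) ^ j)
      (by rw [Polynomial.degree_X_pow, hT]; exact_mod_cast Nat.lt_succ_of_le hj)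
    rw [hT, Nat.add_sub_cancel, Polynomial.coeff_X_pow] at h
    rw [h]
    simp [div_eq_inv_mul]
  have hone : ∑ r ∈ T, (∏ s ∈ T.erase r, (r - s))⁻¹ •
      ∑ k ∈ Finset.range (d + 1), r ^ (d - k) • H k = 1 := by
    simp_rw [Finset.smul_sum, smul_smul]
    rw [Finset.sum_comm]
    simp_rw [← Finset.sum_smul]
    rw [Finset.sum_eq_single_of_mem 0 (by simp), hcoeff _ (by simp)]
    · simp [hH]
    · intro k hk hk0
      rw [Finset.mem_range] at hk
      rw [hcoeff _ (by omega), if_neg (by omega), zero_smul]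
  rw [← mul_one (∏ r ∈ T, U r), ← hone, Finset.mul_sum]
  refine I.sum_mem fun r hr => ?_
  rw [mul_smul_comm, ← Finset.mul_prod_erase T U hr, mul_comm (U r), mul_assoc]
  exact Submodule.smul_of_tower_mem I _ (I.mul_mem_left _ (hU r hr))

lemma QSym_eq_smul_prod (m : ℕ) (S Ω : Finset ℂ) :
    QSym m S Ω = (∏ s ∈ Ω, ∏ r ∈ S \ Ω, (s - r))⁻¹ • ∏ r ∈ S \ Ω, prodXSub m r := by
  apply Subtype.ext
  change _ = _ • ((∏ r ∈ S \ Ω, prodXSub m r : symmetricSubalgebra (Fin m) ℂ) :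
    MvPolynomial (Fin m) ℂ)
  rw [SubmonoidClass.coe_finsetProd, smul_eq_C_mul]
  have hcomm : ∏ i : Fin m, ∏ r ∈ S \ Ω, (X i - C r : MvPolynomial (Fin m) ℂ) =
      ∏ r ∈ S \ Ω, ∏ i : Fin m, (X i - C r) := Finset.prod_comm
  exact congrArg (C (∏ s ∈ Ω, ∏ r ∈ S \ Ω, (s - r))⁻¹ * ·) hcomm

lemma QSym_mul_QSym_mem (m : ℕ) (S : Finset ℂ) (hm : m ≤ S.card) {Ω Ω' : Finset ℂ}
    (hΩ : Ω ∈ S.powersetCard m) (hΩ' : Ω' ∈ S.powersetCard m) (hne : Ω ≠ Ω') :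
    QSym m S Ω * QSym m S Ω' ∈
      Ideal.span ((fun k => hXSElt m S.val k) '' Set.Icc (S.card + 1 - m) S.card) := by
  rw [Finset.mem_powersetCard] at hΩ hΩ'
  obtain ⟨r₀, hr₀, hr₀'⟩ : ∃ r ∈ Ω, r ∉ Ω' := by
    by_contra! h
    exact hne (Finset.eq_of_subset_of_card_le h (by omega))
  have hmem : r₀ ∈ S \ Ω' := Finset.mem_sdiff.2 ⟨hΩ.1 hr₀, hr₀'⟩
  have hnot : r₀ ∉ S \ Ω := fun h => (Finset.mem_sdiff.1 h).2 hr₀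
  rw [QSym_eq_smul_prod, QSym_eq_smul_prod, smul_mul_smul_comm]
  refine Submodule.smul_of_tower_mem _ _ ?_
  rw [← Finset.mul_prod_erase _ _ hmem, ← mul_assoc, mul_comm _ (prodXSub m r₀),
    ← Finset.prod_insert hnot]
  refine Ideal.mul_mem_right _ _ (prod_mem_of_mul_sum_mem _ _ (fun k => hXSElt m S.val k)
    (hXSElt_zero m _) (S.card - m) _ ?_ fun r hr => prodXSub_mul_sum_mem m S hm ?_)
  · rw [Finset.card_insert_of_notMem hnot, Finset.card_sdiff_of_subset hΩ.1, hΩ.2]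
  · rcases Finset.mem_insert.1 hr with rfl | h
    · exact hΩ.1 hr₀
    · exact (Finset.mem_sdiff.1 h).1

lemma degreeOf_QSym_le (m : ℕ) (S Ω : Finset ℂ) (i : Fin m) :
    degreeOf i (QSym m S Ω : MvPolynomial (Fin m) ℂ) ≤ (S \ Ω).card := by
  refine (degreeOf_C_mul_le _ _ _).trans ((degreeOf_prod_le _ _ _).trans ?_)
  refine (Finset.sum_le_sum (g := fun j => if i = j then (S \ Ω).card else 0) fun j _ =>
    (degreeOf_prod_le _ _ _).trans ?_).trans (by simp)
  refine (Finset.sum_le_card_nsmul _ _ (if i = j then 1 else 0) fun r _ =>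
    (degreeOf_sub_le _ _ _).trans ?_).trans ?_
  · simp [degreeOf_X, degreeOf_C]
  · split_ifs <;> simp

lemma degreeOf_det_vandermonde_X_le (R : Type*) [CommRing R] [Nontrivial R] (m : ℕ) (i : Fin m) :
    degreeOf i (Matrix.vandermonde (X : Fin m → MvPolynomial (Fin m) R)).det ≤ m - 1 := by
  rw [Matrix.det_apply]
  refine (degreeOf_sum_le _ _ _).trans (Finset.sup_le fun τ _ => ?_)
  have hsign : degreeOf i (Equiv.Perm.sign τ • ∏ j, Matrix.vandermonde
      (X : Fin m → MvPolynomial (Fin m) R) (τ j) j) ≤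
      degreeOf i (∏ j, Matrix.vandermonde (X : Fin m → MvPolynomial (Fin m) R) (τ j) j) := by
    rcases Int.units_eq_one_or (Equiv.Perm.sign τ) with h | h <;> simp [h, degreeOf_neg]
  refine hsign.trans ((degreeOf_prod_le _ _ _).trans ?_)
  refine (Finset.sum_le_sum (g := fun j => if j = τ.symm i then m - 1 else 0) fun j _ =>
    (degreeOf_pow_le _ _ _).trans ?_).trans (by simp)
  have hiff : i = τ j ↔ j = τ.symm i := by rw [Equiv.eq_symm_apply, eq_comm]
  have := j.2
  rw [degreeOf_X]
  split_ifs <;> omega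

lemma eval_QSym (m : ℕ) (S Ω : Finset ℂ) (x : Fin m → ℂ) :
    eval x (QSym m S Ω : MvPolynomial (Fin m) ℂ) =
      (∏ s ∈ Ω, ∏ r ∈ S \ Ω, (s - r))⁻¹ * ∏ i : Fin m, ∏ r ∈ S \ Ω, (x i - r) := by
  simp [QSym]

lemma eval_sum_QSym (m : ℕ) (S : Finset ℂ) (x : Fin m → ℂ) (hx : ∀ i, x i ∈ S)
    (hinj : Function.Injective x) :
    ∑ Ω ∈ S.powersetCard m, eval x (QSym m S Ω : MvPolynomial (Fin m) ℂ) = 1 := by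
  have hcard : (Finset.univ.image x).card = m := by
    rw [Finset.card_image_of_injective _ hinj, Finset.card_univ, Fintype.card_fin]
  rw [Finset.sum_eq_single_of_mem (Finset.univ.image x)]
  · rw [eval_QSym, Finset.prod_image fun i _ j _ h => hinj h]
    refine inv_mul_cancel₀ (Finset.prod_ne_zero_iff.2 fun i _ => Finset.prod_ne_zero_iff.2
      fun r hr => sub_ne_zero.2 ?_)
    rintro rfl
    simp at hr
  · rw [Finset.mem_powersetCard]
    exact ⟨Finset.image_subset_iff.2 fun i _ => hx i, hcard⟩
  · intro Ω hΩ hne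
    rw [Finset.mem_powersetCard] at hΩ
    obtain ⟨i, hi⟩ : ∃ i, x i ∉ Ω := by
      by_contra! h
      exact hne (Finset.eq_of_subset_of_card_le (Finset.image_subset_iff.2 fun i _ => h i)
        (by omega)).symm
    rw [eval_QSym, Finset.prod_eq_zero (Finset.mem_univ i) (Finset.prod_eq_zero
      (Finset.mem_sdiff.2 ⟨hx i, hi⟩) (sub_self _)), mul_zero]

lemma sum_QSym (m : ℕ) (S : Finset ℂ) (hm : m ≤ S.card) :
    ∑ Ω ∈ S.powersetCard m, (QSym m S Ω : MvPolynomial (Fin m) ℂ) = 1 := by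
  have hV : (Matrix.vandermonde (X : Fin m → MvPolynomial (Fin m) ℂ)).det ≠ 0 :=
    Matrix.det_vandermonde_ne_zero_iff.2 (X_injective)
  rw [← sub_eq_zero]
  refine (mul_eq_zero.1 (eq_zero_of_eval_zero_at_prod_finset (_ * _) (fun _ => S) ?_ ?_)).resolve_left
    hV
  · intro i
    have hsum : degreeOf i (∑ Ω ∈ S.powersetCard m, (QSym m S Ω : MvPolynomial (Fin m) ℂ) - 1) ≤
        S.card - m := by
      refine (degreeOf_sub_le _ _ _).trans (max_le ((degreeOf_sum_le _ _ _).trans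
        (Finset.sup_le fun Ω hΩ => (degreeOf_QSym_le m S Ω i).trans ?_)) (by simp))
      rw [Finset.mem_powersetCard] at hΩ
      rw [Finset.card_sdiff_of_subset hΩ.1, hΩ.2]
    have hle := (degreeOf_mul_le i _ _).trans
      (add_le_add (degreeOf_det_vandermonde_X_le ℂ m i) hsum)
    have := i.2
    omega
  · intro x hx
    rw [map_mul]
    by_cases hinj : Function.Injective x
    · rw [map_sub, map_sum, eval_sum_QSym m S x hx hinj, map_one, sub_self, mul_zero]
    · have hdet : eval x (Matrix.vandermonde (X : Fin m → MvPolynomial (Fin m) ℂ)).det =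
          (Matrix.vandermonde x).det := by
        simp [Matrix.det_vandermonde]
      rw [hdet, not_not.1 (mt Matrix.det_vandermonde_ne_zero_iff.1 hinj), zero_mul]

/-- (i) `∑_{Ω ⊆ Σ, |Ω| = m} Q_Ω = 1` in `ℂ[x₁,…,x_m]`; (ii) each `Q_Ω² − Q_Ω` lies in the ideal
`I = (h_{N+1−m}(X−Σ), …, h_N(X−Σ))` of the ring of symmetric polynomials; (iii) for `Ω ≠ Ω'`,
`Q_Ω·Q_{Ω'} ∈ I`.  That is, the images of the `Q_Ω` in `Sym/I` are pairwise orthogonal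
idempotents summing to `1`. -/
theorem Q_idempotents (N m : ℕ) (hm : 1 ≤ m) (hmN : m ≤ N)
    (S : Finset ℂ) (hS : S.card = N) :
    (∑ Ω ∈ S.powersetCard m, (QSym m S Ω : MvPolynomial (Fin m) ℂ) = 1) ∧
    (∀ Ω ∈ S.powersetCard m,
      QSym m S Ω ^ 2 - QSym m S Ω ∈
        Ideal.span ((fun k => hXSElt m S.val k) '' Set.Icc (N + 1 - m) N)) ∧
    (∀ Ω ∈ S.powersetCard m, ∀ Ω' ∈ S.powersetCard m, Ω ≠ Ω' →
      QSym m S Ω * QSym m S Ω' ∈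
        Ideal.span ((fun k => hXSElt m S.val k) '' Set.Icc (N + 1 - m) N)) := by
  subst hS
  refine ⟨sum_QSym m S hmN, fun Ω hΩ => ?_,
    fun Ω hΩ Ω' hΩ' hne => QSym_mul_QSym_mem m S hmN hΩ hΩ' hne⟩
  have hone : ∑ Ω' ∈ S.powersetCard m, QSym m S Ω' = 1 := by
    apply Subtype.ext
    rw [AddSubmonoidClass.coe_finsetSum]
    exact sum_QSym m S hmN
  have hsub : QSym m S Ω ^ 2 - QSym m S Ω =
      -∑ Ω' ∈ (S.powersetCard m).erase Ω, QSym m S Ω * QSym m S Ω' := by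
    rw [← Finset.add_sum_erase _ _ hΩ] at hone
    rw [← Finset.mul_sum]
    linear_combination QSym m S Ω * hone
  rw [hsub]
  exact neg_mem (sum_mem fun Ω' hΩ' => QSym_mul_QSym_mem m S hmN hΩ
    (Finset.mem_of_mem_erase hΩ') (Finset.ne_of_mem_erase hΩ').symm)
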